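/- Let T be the truncated Fourier–Plancherel operator on L²(ℝ⁺). Then the spectral radius of T equals 1/√2. -/

import Mathlib

open MeasureTheory Set

/-- Lebesgue measure restricted to `(0,∞)`. -/
noncomputable def m0 : Measure ℝ := volume.restrict (Ioi (0:ℝ))


noncomputable def kk (s r : ℝ) : ℝ := √s / (√r * (s + r))

lemma kk_deriv {s r : ℝ} (hs : 0 < s) (hr : 0 < r) :
    HasDerivAt (fun r => 2 * Real.arctan (√r / √s)) (kk s r) r := by
  have h1 := ((Real.hasDerivAt_sqrt hr.ne').div_const (√s)).arctan.const_mul 2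
  refine h1.congr_deriv ?_
  have h2 : 0 < √s := Real.sqrt_pos.2 hs
  have h3 : 0 < √r := Real.sqrt_pos.2 hr
  unfold kk
  rw [div_pow, Real.sq_sqrt hs.le, Real.sq_sqrt hr.le]
  field_simp
  rw [Real.sq_sqrt hs.le]

lemma kk_nonneg {s r : ℝ} (hs : 0 < s) (hr : 0 < r) : 0 ≤ kk s r := by
  unfold kk; positivity

lemma kk_cont (s : ℝ) : ContinuousWithinAt (fun r => 2 * Real.arctan (√r / √s)) (Ici 0) 0 := by
  apply Continuous.continuousWithinAt
  fun_prop

lemma kk_lim {s : ℝ} (hs : 0 < s) :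
    Filter.Tendsto (fun r => 2 * Real.arctan (√r / √s)) Filter.atTop (nhds Real.pi) := by
  have h2 : 0 < √s := Real.sqrt_pos.2 hs
  have := (Real.tendsto_arctan_atTop.mono_right nhdsWithin_le_nhds).comp
    (Real.tendsto_sqrt_atTop.atTop_div_const h2)
  have := this.const_mul 2
  rw [show 2 * (Real.pi / 2) = Real.pi by ring] at this
  exact this

lemma kk_integrable {s : ℝ} (hs : 0 < s) : Integrable (kk s) m0 :=
  integrableOn_Ioi_deriv_of_nonneg (kk_cont s) (fun _ hr => kk_deriv hs hr)
    (fun _ hr => kk_nonneg hs hr) (kk_lim hs)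

lemma kk_integral {s : ℝ} (hs : 0 < s) : ∫ r, kk s r ∂m0 = Real.pi := by
  have := integral_Ioi_of_hasDerivAt_of_nonneg (kk_cont s) (fun _ hr => kk_deriv hs hr)
    (fun _ hr => kk_nonneg hs hr) (kk_lim hs)
  unfold m0
  rw [this]; simp

lemma m0_pos : ∀ᵐ s ∂m0, 0 < s := by
  unfold m0
  exact ae_restrict_mem measurableSet_Ioi

instance : SFinite m0 := by unfold m0; infer_instance

instance : SigmaFinite m0 := by unfold m0; infer_instance

lemma kk_meas : Measurable (Function.uncurry kk) := by
  unfold kk Function.uncurry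
  fun_prop

lemma sq_integrable (x : Lp ℂ 2 m0) : Integrable (fun s => ‖x s‖ ^ 2) m0 :=
  (Lp.memLp x).integrable_norm_pow (by norm_num)

lemma sq_integral (x : Lp ℂ 2 m0) : ∫ s, ‖x s‖ ^ 2 ∂m0 = ‖x‖ ^ 2 := by
  have h := L2.inner_def (𝕜 := ℂ) x x
  rw [inner_self_eq_norm_sq_to_K] at h
  have h2 : ∀ a, inner ℂ (x a) (x a) = ((‖x a‖ ^ 2 : ℝ) : ℂ) := fun a => by
    rw [inner_self_eq_norm_sq_to_K]; simp
  simp_rw [h2] at h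
  rw [integral_complex_ofReal] at h
  have : ((‖x‖ ^ 2 : ℝ) : ℂ) = (∫ s, ‖x s‖ ^ 2 ∂m0 : ℝ) := by rw [← h]; simp
  exact_mod_cast this.symm

lemma schur_int (x : Lp ℂ 2 m0) :
    Integrable (fun p : ℝ × ℝ => ‖x p.1‖ ^ 2 * kk p.1 p.2) (m0.prod m0) := by
  have hm : AEStronglyMeasurable (fun p : ℝ × ℝ => ‖x p.1‖ ^ 2 * kk p.1 p.2) (m0.prod m0) := by
    refine AEStronglyMeasurable.mul ?_ kk_meas.aestronglyMeasurable
    exact (sq_integrable x).aestronglyMeasurable.comp_fst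
  rw [integrable_prod_iff hm]
  constructor
  · filter_upwards [m0_pos] with s hs
    exact (kk_integrable hs).const_mul _
  · refine ((sq_integrable x).mul_const Real.pi).congr ?_
    filter_upwards [m0_pos] with s hs
    rw [← kk_integral hs, ← integral_const_mul]
    apply integral_congr_ae
    filter_upwards [m0_pos] with r hr
    rw [Real.norm_of_nonneg]
    have := kk_nonneg hs hr
    positivity

lemma schur_val (x : Lp ℂ 2 m0) :
    ∫ p, ‖x p.1‖ ^ 2 * kk p.1 p.2 ∂(m0.prod m0) = Real.pi * ‖x‖ ^ 2 := by
  rw [integral_prod _ (schur_int x), ← sq_integral, ← integral_const_mul]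
  apply integral_congr_ae
  filter_upwards [m0_pos] with s hs
  rw [integral_const_mul, kk_integral hs, mul_comm]

lemma m0_prod_pos : ∀ᵐ p ∂(m0.prod m0), 0 < p.1 ∧ 0 < p.2 := by
  have h1 := Measure.quasiMeasurePreserving_fst (μ := m0) (ν := m0) |>.ae m0_pos
  have h2 := Measure.quasiMeasurePreserving_snd (μ := m0) (ν := m0) |>.ae m0_pos
  filter_upwards [h1, h2] with p a b using ⟨a, b⟩

lemma schur_pt {s r a b : ℝ} (hs : 0 < s) (hr : 0 < r) :
    a * b / (s + r) ≤ (a ^ 2 * kk s r + b ^ 2 * kk r s) / 2 := by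
  have h2 : 0 < √s := Real.sqrt_pos.2 hs
  have h3 : 0 < √r := Real.sqrt_pos.2 hr
  unfold kk
  rw [add_comm r s]
  have : (a ^ 2 * (√s / (√r * (s + r))) + b ^ 2 * (√r / (√s * (s + r)))) / 2 - a * b / (s + r)
      = (a * √s - b * √r) ^ 2 / (2 * √r * √s * (s + r)) := by
    field_simp
    ring
  have h4 : 0 ≤ (a * √s - b * √r) ^ 2 / (2 * √r * √s * (s + r)) := by positivity
  linarith

/-- the majorant -/
noncomputable def maj (x y : Lp ℂ 2 m0) (p : ℝ × ℝ) : ℝ :=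
  (‖x p.1‖ ^ 2 * kk p.1 p.2 + ‖y p.2‖ ^ 2 * kk p.2 p.1) / 2

lemma maj_int (x y : Lp ℂ 2 m0) : Integrable (maj x y) (m0.prod m0) :=
  ((schur_int x).add (schur_int y).swap).div_const 2

lemma maj_val (x y : Lp ℂ 2 m0) :
    ∫ p, maj x y p ∂(m0.prod m0) = Real.pi / 2 * (‖x‖ ^ 2 + ‖y‖ ^ 2) := by
  unfold maj
  have h := integral_prod_swap (μ := m0) (ν := m0) (fun p : ℝ × ℝ => ‖y p.1‖ ^ 2 * kk p.1 p.2)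
  simp only [Prod.fst_swap, Prod.snd_swap] at h
  have h2 : Integrable (fun p : ℝ × ℝ => ‖y p.2‖ ^ 2 * kk p.2 p.1) (m0.prod m0) :=
    (schur_int y).swap
  rw [integral_div, integral_add (schur_int x) h2, schur_val, h, schur_val]
  ring

/-- the Carleman form -/
noncomputable def K (x y : Lp ℂ 2 m0) : ℂ :=
  ∫ p, x p.1 * y p.2 / ((p.1 + p.2 : ℝ) : ℂ) ∂(m0.prod m0)

lemma K_bound (x y : Lp ℂ 2 m0) : ‖K x y‖ ≤ Real.pi / 2 * (‖x‖ ^ 2 + ‖y‖ ^ 2) := by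
  rw [← maj_val]
  apply norm_integral_le_of_norm_le (maj_int x y)
  filter_upwards [m0_prod_pos] with p hp
  have h0 : 0 < p.1 + p.2 := add_pos hp.1 hp.2
  rw [norm_div, norm_mul, Complex.norm_real, Real.norm_of_nonneg h0.le]
  exact schur_pt hp.1 hp.2

lemma K_symm (x y : Lp ℂ 2 m0) : K x y = K y x := by
  unfold K
  rw [← integral_prod_swap]
  simp only [Prod.fst_swap, Prod.snd_swap]
  congr 1; ext p; rw [mul_comm, add_comm]

lemma K_star (x y : Lp ℂ 2 m0) : K (star x) (star y) = star (K x y) := by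
  unfold K
  rw [RCLike.star_def, ← integral_conj]
  apply integral_congr_ae
  have h1 := Measure.quasiMeasurePreserving_fst (μ := m0) (ν := m0) |>.ae (Lp.coeFn_star x)
  have h2 := Measure.quasiMeasurePreserving_snd (μ := m0) (ν := m0) |>.ae (Lp.coeFn_star y)
  filter_upwards [h1, h2] with p h1 h2
  rw [h1, h2]
  simp

/-- the bilinear pairing -/
noncomputable def BB (x y : Lp ℂ 2 m0) : ℂ := inner ℂ (star x) y

lemma BB_eq (x y : Lp ℂ 2 m0) : BB x y = ∫ t, x t * y t ∂m0 := by
  unfold BB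
  rw [L2.inner_def]
  apply integral_congr_ae
  filter_upwards [Lp.coeFn_star x] with t h
  simp only [h]
  simp [mul_comm]

lemma star_cont : Continuous (star : Lp ℂ 2 m0 → Lp ℂ 2 m0) := by
  have : Isometry (star : Lp ℂ 2 m0 → Lp ℂ 2 m0) := by
    refine Isometry.of_dist_eq fun x y => ?_
    rw [Lp.dist_def, Lp.dist_def]
    congr 1
    apply eLpNorm_congr_norm_ae
    filter_upwards [Lp.coeFn_star x, Lp.coeFn_star y] with t h1 h2
    simp only [Pi.sub_apply, h1, h2, Pi.star_apply]
    rw [← star_sub, norm_star]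
  exact this.continuous

lemma dense_int : Dense {x : Lp ℂ 2 m0 | Integrable x m0} := by
  have h := Lp.simpleFunc.denseRange (E := ℂ) (μ := m0) (p := 2) (by norm_num)
  refine h.mono ?_
  rintro _ ⟨f, rfl⟩
  have h1 : MemLp (Lp.simpleFunc.toSimpleFunc f) 2 m0 := Lp.simpleFunc.memLp f
  have h2 := (SimpleFunc.memLp_iff_integrable (by norm_num) (by norm_num)).1 h1
  exact h2.congr (Lp.simpleFunc.toSimpleFunc_eq_toFun f)

lemma exp_norm (t s : ℝ) : ‖Complex.exp (Complex.I * t * s)‖ = 1 := by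
  rw [show Complex.I * t * s = ((t * s : ℝ) : ℂ) * Complex.I by push_cast; ring]
  exact Complex.norm_exp_ofReal_mul_I _

lemma reg_int {f g : ℝ → ℂ} (hf : Integrable f m0) (hg : Integrable g m0) {ε : ℝ} (hε : 0 < ε) :
    ∫ t, Complex.exp (-ε * t) * ((∫ s, f s * Complex.exp (Complex.I * t * s) ∂m0) *
      (∫ r, g r * Complex.exp (Complex.I * t * r) ∂m0)) ∂m0 =
    ∫ p, f p.1 * g p.2 * (1 / (ε - Complex.I * ((p.1 + p.2 : ℝ) : ℂ))) ∂(m0.prod m0) := by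
  have h1 : ∀ t : ℝ, Complex.exp (-ε * t) * ((∫ s, f s * Complex.exp (Complex.I * t * s) ∂m0) *
      (∫ r, g r * Complex.exp (Complex.I * t * r) ∂m0)) =
      ∫ p, f p.1 * g p.2 * Complex.exp ((-ε + Complex.I * ((p.1 + p.2 : ℝ) : ℂ)) * t)
        ∂(m0.prod m0) := by
    intro t
    rw [← integral_prod_mul, ← integral_const_mul]
    congr 1; ext p
    rw [show (-ε + Complex.I * ((p.1 + p.2 : ℝ) : ℂ)) * t =
      -ε * t + (Complex.I * t * p.1 + Complex.I * t * p.2) by push_cast; ring,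
      Complex.exp_add, Complex.exp_add]
    ring
  simp_rw [h1]
  rw [integral_integral_swap]
  · congr 1; ext p
    rw [integral_const_mul]
    congr 1
    unfold m0
    rw [integral_exp_mul_complex_Ioi (by simpa using hε)]
    simp only [Complex.ofReal_zero, mul_zero, Complex.exp_zero]
    rw [neg_div, ← div_neg]
    congr 1; ring
  · have hE : Integrable (fun t : ℝ => Complex.exp (-ε * t)) m0 :=
      integrableOn_exp_mul_complex_Ioi (by simpa using hε) 0
    have h2 := hE.mul_prod (hf.mul_prod hg)
    have h3 : AEStronglyMeasurable (fun q : ℝ × ℝ × ℝ =>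
      Complex.exp (Complex.I * ((q.2.1 + q.2.2 : ℝ) : ℂ) * q.1)) (m0.prod (m0.prod m0)) := by
      apply Continuous.aestronglyMeasurable
      fun_prop
    have h4 := h2.mul_bdd (c := 1) h3 (Filter.Eventually.of_forall fun q => by
      have := exp_norm (q.2.1 + q.2.2) q.1
      exact this.le)
    refine h4.congr (Filter.Eventually.of_forall fun q => ?_)
    simp only [Function.uncurry]
    rw [add_mul, Complex.exp_add]
    ring

lemma eps_lim : Filter.Tendsto (fun n : ℕ => (1 / ((n:ℝ) + 1))) Filter.atTop (nhds 0) :=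
  tendsto_one_div_add_atTop_nhds_zero_nat

lemma main_id (x y u v : Lp ℂ 2 m0) (hx : Integrable x m0) (hy : Integrable y m0)
    (hu : u =ᵐ[m0] fun t => (Real.sqrt (2 * Real.pi) : ℂ)⁻¹ *
          ∫ ξ, x ξ * Complex.exp (Complex.I * t * ξ) ∂m0)
    (hv : v =ᵐ[m0] fun t => (Real.sqrt (2 * Real.pi) : ℂ)⁻¹ *
          ∫ ξ, y ξ * Complex.exp (Complex.I * t * ξ) ∂m0) :
    BB u v = Complex.I / (2 * Real.pi) * K x y := by
  rw [BB_eq]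
  have hL : Filter.Tendsto (fun n : ℕ => ∫ t, Complex.exp (-((1 / ((n:ℝ) + 1) : ℝ) : ℂ) * t) *
      (u t * v t) ∂m0) Filter.atTop (nhds (∫ t, u t * v t ∂m0)) := by
    have huv : Integrable (fun t => u t * v t) m0 := (Lp.memLp u).integrable_mul (Lp.memLp v)
    apply tendsto_integral_of_dominated_convergence (fun t => ‖u t * v t‖)
    · intro n
      refine AEStronglyMeasurable.mul ?_ huv.aestronglyMeasurable
      apply Continuous.aestronglyMeasurable
      fun_prop
    · exact huv.norm
    · intro n
      filter_upwards [m0_pos] with t ht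
      rw [norm_mul]
      apply mul_le_of_le_one_left (norm_nonneg _)
      rw [Complex.norm_exp, ← Complex.ofReal_neg, ← Complex.ofReal_mul, Complex.ofReal_re,
        Real.exp_le_one_iff, neg_mul]
      have : 0 ≤ 1 / ((n:ℝ) + 1) * t := by positivity
      linarith
    · refine Filter.Eventually.of_forall fun t => ?_
      have h1 : Continuous fun e : ℝ => Complex.exp (-(e : ℂ) * t) * (u t * v t) := by fun_prop
      have := (h1.tendsto 0).comp eps_lim
      rw [show Complex.exp (-((0 : ℝ) : ℂ) * t) * (u t * v t) = u t * v t by simp] at this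
      exact this
  have hR : Filter.Tendsto (fun n : ℕ => ∫ p, x p.1 * y p.2 *
      (1 / (((1 / ((n:ℝ) + 1) : ℝ) : ℂ) - Complex.I * ((p.1 + p.2 : ℝ) : ℂ))) ∂(m0.prod m0))
      Filter.atTop (nhds (Complex.I * K x y)) := by
    unfold K
    rw [← integral_const_mul]
    have hxy : AEStronglyMeasurable (fun p : ℝ × ℝ => x p.1 * y p.2) (m0.prod m0) :=
      (hx.mul_prod hy).aestronglyMeasurable
    apply tendsto_integral_of_dominated_convergence (maj x y)
    · intro n
      refine hxy.mul ?_
      apply Measurable.aestronglyMeasurable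
      fun_prop
    · exact maj_int x y
    · intro n
      filter_upwards [m0_prod_pos] with p hp
      have h0 : 0 < p.1 + p.2 := add_pos hp.1 hp.2
      refine le_trans ?_ (schur_pt hp.1 hp.2)
      rw [norm_mul, norm_mul, norm_div, norm_one, mul_one_div]
      gcongr
      have := Complex.abs_im_le_norm
        (((1 / ((n:ℝ) + 1) : ℝ) : ℂ) - Complex.I * ((p.1 + p.2 : ℝ) : ℂ))
      rw [Complex.sub_im, Complex.ofReal_im, Complex.I_mul_im, Complex.ofReal_re, zero_sub,
        abs_neg, abs_of_pos h0] at this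
      exact this
    · filter_upwards [m0_prod_pos] with p hp
      have h0 : 0 < p.1 + p.2 := add_pos hp.1 hp.2
      have h00 : ((p.1 + p.2 : ℝ) : ℂ) ≠ 0 := by exact_mod_cast h0.ne'
      have h1 : ContinuousAt (fun e : ℝ => x p.1 * y p.2 *
        (1 / ((e : ℂ) - Complex.I * ((p.1 + p.2 : ℝ) : ℂ)))) 0 := by
        refine ContinuousAt.mul continuousAt_const (ContinuousAt.div continuousAt_const ?_ ?_)
        · fun_prop
        · rw [Complex.ofReal_zero, zero_sub]
          exact neg_ne_zero.2 (mul_ne_zero Complex.I_ne_zero h00)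
      have := h1.tendsto.comp eps_lim
      have e : x p.1 * y p.2 * (1 / (((0 : ℝ) : ℂ) - Complex.I * ((p.1 + p.2 : ℝ) : ℂ))) =
          Complex.I * (x p.1 * y p.2 / ((p.1 + p.2 : ℝ) : ℂ)) := by
        rw [Complex.ofReal_zero, zero_sub, one_div, ← mul_neg_one, mul_inv, mul_inv, Complex.inv_I]
        rw [div_eq_mul_inv]
        norm_num
        ring
      rw [e] at this
      exact this
  have hE : ∀ n : ℕ, ∫ t, Complex.exp (-((1 / ((n:ℝ) + 1) : ℝ) : ℂ) * t) * (u t * v t) ∂m0 =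
      (1 / (2 * Real.pi)) * ∫ p, x p.1 * y p.2 *
      (1 / (((1 / ((n:ℝ) + 1) : ℝ) : ℂ) - Complex.I * ((p.1 + p.2 : ℝ) : ℂ))) ∂(m0.prod m0) := by
    intro n
    rw [← reg_int hx hy (by positivity), ← integral_const_mul]
    apply integral_congr_ae
    filter_upwards [hu, hv] with t h1 h2
    rw [h1, h2]
    have : ((Real.sqrt (2 * Real.pi) : ℂ)⁻¹) * (Real.sqrt (2 * Real.pi) : ℂ)⁻¹ =
        1 / (2 * Real.pi) := by
      rw [← mul_inv, ← Complex.ofReal_mul, Real.mul_self_sqrt (by positivity)]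
      push_cast; simp
    rw [← this]
    ring
  simp_rw [hE] at hL
  have := tendsto_nhds_unique hL (hR.const_mul _)
  rw [this]; ring

lemma BB_T (x y u v : Lp ℂ 2 m0) (hx : Integrable x m0) (hy : Integrable y m0)
    (hu : u =ᵐ[m0] fun t => (Real.sqrt (2 * Real.pi) : ℂ)⁻¹ *
          ∫ ξ, x ξ * Complex.exp (Complex.I * t * ξ) ∂m0)
    (hv : v =ᵐ[m0] fun t => (Real.sqrt (2 * Real.pi) : ℂ)⁻¹ *
          ∫ ξ, y ξ * Complex.exp (Complex.I * t * ξ) ∂m0) :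
    BB u y = BB x v := by
  rw [BB_eq, BB_eq]
  have e1 : ∫ t, u t * y t ∂m0 = ∫ t, ∫ ξ, (Real.sqrt (2 * Real.pi) : ℂ)⁻¹ * (x ξ * y t) *
      Complex.exp (Complex.I * t * ξ) ∂m0 ∂m0 := by
    apply integral_congr_ae
    filter_upwards [hu] with t h
    rw [h, mul_assoc, mul_comm _ (y t), ← integral_const_mul, ← integral_const_mul]
    congr 1; ext s; ring
  have e2 : ∫ t, x t * v t ∂m0 = ∫ t, ∫ ξ, (Real.sqrt (2 * Real.pi) : ℂ)⁻¹ * (x t * y ξ) *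
      Complex.exp (Complex.I * ξ * t) ∂m0 ∂m0 := by
    apply integral_congr_ae
    filter_upwards [hv] with t h
    rw [h, ← integral_const_mul, ← integral_const_mul]
    congr 1; ext s
    rw [show Complex.I * s * t = Complex.I * t * s by ring]; ring
  rw [e1, e2, integral_integral_swap]
  have h1 := ((hy.mul_prod hx).const_mul (Real.sqrt (2 * Real.pi) : ℂ)⁻¹).mul_bdd (c := 1)
    (g := fun q : ℝ × ℝ => Complex.exp (Complex.I * q.1 * q.2))
    (by apply Continuous.aestronglyMeasurable; fun_prop)
    (Filter.Eventually.of_forall fun q => (exp_norm q.1 q.2).le)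
  refine h1.congr (Filter.Eventually.of_forall fun q => ?_)
  simp only [Function.uncurry]
  ring

lemma K_int (x y : Lp ℂ 2 m0) :
    Integrable (fun p : ℝ × ℝ => x p.1 * y p.2 / ((p.1 + p.2 : ℝ) : ℂ)) (m0.prod m0) := by
  refine (maj_int x y).mono' ?_ ?_
  · refine AEStronglyMeasurable.div₀ (AEStronglyMeasurable.mul ?_ ?_) ?_
    · exact (Lp.aestronglyMeasurable x).comp_fst
    · exact (Lp.aestronglyMeasurable y).comp_snd
    · apply Continuous.aestronglyMeasurable
      fun_prop
  · filter_upwards [m0_prod_pos] with p hp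
    have h0 : 0 < p.1 + p.2 := add_pos hp.1 hp.2
    rw [norm_div, norm_mul, Complex.norm_real, Real.norm_of_nonneg h0.le]
    exact schur_pt hp.1 hp.2

lemma m0_icc (b : ℝ) : m0.restrict (Icc 1 b) = volume.restrict (Icc 1 b) := by
  unfold m0
  rw [Measure.restrict_restrict_of_subset]
  intro t ht
  exact lt_of_lt_of_le one_pos ht.1

lemma ind_int {b : ℝ} (hb : 1 ≤ b) (F : ℝ → ℝ) :
    ∫ t, (Icc 1 b).indicator F t ∂m0 = ∫ t in (1:ℝ)..b, F t := by
  rw [integral_indicator measurableSet_Icc, m0_icc, integral_Icc_eq_integral_Ioc,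
    intervalIntegral.integral_of_le hb]

noncomputable def phi (b : ℝ) : ℝ → ℝ := (Icc 1 b).indicator fun s => (√s)⁻¹

lemma sqrt_cont {b : ℝ} : ContinuousOn (fun s : ℝ => (√s)⁻¹) (Icc 1 b) := by
  refine ContinuousOn.inv₀ Real.continuous_sqrt.continuousOn fun s hs => ?_
  exact (Real.sqrt_pos.2 (lt_of_lt_of_le one_pos hs.1)).ne'

lemma ind_integrable {b : ℝ} {F : ℝ → ℝ} (hF : ContinuousOn F (Icc 1 b)) :
    Integrable ((Icc 1 b).indicator F) m0 := by
  rw [integrable_indicator_iff measurableSet_Icc, IntegrableOn, m0_icc]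
  exact hF.integrableOn_Icc

lemma phi_integrable (b : ℝ) : Integrable (fun s => (phi b s : ℂ)) m0 :=
  (ind_integrable sqrt_cont).ofReal

lemma phi_memLp (b : ℝ) : MemLp (fun s => (phi b s : ℂ)) 2 m0 := by
  rw [memLp_two_iff_integrable_sq_norm (phi_integrable b).aestronglyMeasurable]
  have := ind_integrable (b := b) (sqrt_cont.pow 2)
  refine this.congr (Filter.Eventually.of_forall fun s => ?_)
  simp only [phi, Complex.norm_real, indicator]
  split_ifs <;> simp

noncomputable def xx (b : ℝ) : Lp ℂ 2 m0 := (phi_memLp b).toLp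

lemma xx_ae (b : ℝ) : xx b =ᵐ[m0] fun s => (phi b s : ℂ) := (phi_memLp b).coeFn_toLp

lemma xx_norm {b : ℝ} (hb : 1 ≤ b) : ‖xx b‖ ^ 2 = Real.log b := by
  rw [← sq_integral]
  have : ∫ s, ‖xx b s‖ ^ 2 ∂m0 = ∫ s, (Icc 1 b).indicator (fun s => s⁻¹) s ∂m0 := by
    apply integral_congr_ae
    filter_upwards [xx_ae b, m0_pos] with s h hs
    rw [h]
    simp only [phi, Complex.norm_real, indicator]
    split_ifs <;> simp [hs.le]
  rw [this, ind_int hb, integral_inv_of_pos one_pos (by linarith), div_one]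

lemma xx_star (b : ℝ) : star (xx b) = xx b := by
  apply Lp.ext
  filter_upwards [Lp.coeFn_star (xx b), xx_ae b] with s h1 h2
  rw [h1, Pi.star_apply, h2]
  simp

lemma arctan_le_self' {t : ℝ} (ht : 0 < t) : Real.arctan t ≤ t := by
  have h1 : 0 < Real.arctan t := Real.arctan_pos.2 ht
  have := Real.lt_tan h1 (Real.arctan_lt_pi_div_two t)
  rw [Real.tan_arctan] at this
  exact this.le

lemma inner_lower {b s : ℝ} (hs : s ∈ Icc 1 b) :
    Real.pi - 2 * √s / √b - 2 / √s ≤ ∫ r in (1:ℝ)..b, kk s r := by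
  have hb : 1 ≤ b := hs.1.trans hs.2
  have hs0 : 0 < s := lt_of_lt_of_le one_pos hs.1
  have h1 : 0 < √s := Real.sqrt_pos.2 hs0
  have h2 : 0 < √b := Real.sqrt_pos.2 (by linarith)
  have hpos : ∀ r ∈ uIcc 1 b, 0 < r := fun r hr => by
    rw [uIcc_of_le hb] at hr; exact lt_of_lt_of_le one_pos hr.1
  rw [intervalIntegral.integral_eq_sub_of_hasDerivAt (fun r hr => kk_deriv hs0 (hpos r hr))]
  · have e1 : Real.arctan (√b / √s) = Real.pi / 2 - Real.arctan (√s / √b) := by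
      rw [← Real.arctan_inv_of_pos (by positivity), inv_div]
    have e2 := arctan_le_self' (t := √s / √b) (by positivity)
    have e3 := arctan_le_self' (t := 1 / √s) (by positivity)
    rw [e1, Real.sqrt_one]
    have : 2 * √s / √b = 2 * (√s / √b) := by ring
    have h5 : 2 / √s = 2 * (1 / √s) := by ring
    linarith
  · apply ContinuousOn.intervalIntegrable
    unfold kk
    intro r hr
    have hr0 := hpos r hr
    have : √r * (s + r) ≠ 0 := by positivity
    apply ContinuousAt.continuousWithinAt
    exact ContinuousAt.div continuousAt_const (by fun_prop) this

lemma outer_cont {b : ℝ} (hb : 1 ≤ b) :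
    ContinuousOn (fun s => s⁻¹ * (Real.pi - 2 * √s / √b - 2 / √s)) (Icc 1 b) := by
  intro s hs
  have hs0 : 0 < s := lt_of_lt_of_le one_pos hs.1
  have h1 : 0 < √s := Real.sqrt_pos.2 hs0
  apply ContinuousAt.continuousWithinAt
  refine ContinuousAt.mul (continuousAt_inv₀ hs0.ne') ?_
  refine ContinuousAt.sub (by fun_prop) ?_
  exact ContinuousAt.div continuousAt_const (by fun_prop) h1.ne'

lemma outer_lower {b : ℝ} (hb : 1 ≤ b) :
    Real.pi * Real.log b - 8 ≤
      ∫ s in (1:ℝ)..b, s⁻¹ * (Real.pi - 2 * √s / √b - 2 / √s) := by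
  have h2 : 0 < √b := Real.sqrt_pos.2 (by linarith)
  rw [intervalIntegral.integral_eq_sub_of_hasDerivAt
    (f := fun s => Real.pi * Real.log s - 4 / √b * √s + 4 * (√s)⁻¹)]
  · simp only [Real.log_one, Real.sqrt_one]
    have : 4 / √b * √b = 4 := by field_simp
    rw [this]
    have : 0 < 4 / √b * 1 := by positivity
    have : 0 < 4 * (√b)⁻¹ := by positivity
    rw [mul_zero, inv_one]
    linarith
  · intro s hs
    rw [uIcc_of_le hb] at hs
    have hs0 : 0 < s := lt_of_lt_of_le one_pos hs.1
    have h1 : 0 < √s := Real.sqrt_pos.2 hs0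
    have d1 := (Real.hasDerivAt_log hs0.ne').const_mul Real.pi
    have d2 := (Real.hasDerivAt_sqrt hs0.ne').const_mul (4 / √b)
    have d3 := ((Real.hasDerivAt_sqrt hs0.ne').inv h1.ne').const_mul 4
    refine ((d1.sub d2).add d3).congr_deriv ?_
    have e : s = √s ^ 2 := (Real.sq_sqrt hs0.le).symm
    generalize √s = w at *
    subst e
    field_simp
    ring
  · apply ContinuousOn.intervalIntegrable
    rw [uIcc_of_le hb]
    exact outer_cont hb

lemma K_lower {b : ℝ} (hb : 1 ≤ b) : Real.pi * Real.log b - 8 ≤ ‖K (xx b) (xx b)‖ := by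
  set G : ℝ × ℝ → ℝ := fun p => phi b p.1 * phi b p.2 / (p.1 + p.2) with hG
  have h1 := Measure.quasiMeasurePreserving_fst (μ := m0) (ν := m0) |>.ae (xx_ae b)
  have h2 := Measure.quasiMeasurePreserving_snd (μ := m0) (ν := m0) |>.ae (xx_ae b)
  have hae : (fun p : ℝ × ℝ => xx b p.1 * xx b p.2 / ((p.1 + p.2 : ℝ) : ℂ)) =ᵐ[m0.prod m0]
      fun p => ((G p : ℝ) : ℂ) := by
    filter_upwards [h1, h2] with p h1 h2
    rw [h1, h2, hG]
    push_cast; rfl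
  have hKe : K (xx b) (xx b) = ((∫ p, G p ∂(m0.prod m0) : ℝ) : ℂ) := by
    rw [← integral_complex_ofReal]
    exact integral_congr_ae hae
  have hGi : Integrable G (m0.prod m0) := by
    have := ((K_int (xx b) (xx b)).congr hae).re
    exact this
  rw [hKe, Complex.norm_real]
  refine le_trans ?_ (le_abs_self _)
  refine (outer_lower hb).trans ?_
  rw [integral_prod _ hGi, ← ind_int hb]
  refine integral_mono_ae (ind_integrable (outer_cont hb)) hGi.integral_prod_left ?_
  filter_upwards [m0_pos] with s hs
  by_cases hsb : s ∈ Icc 1 b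
  · rw [indicator_of_mem hsb]
    have e : ∫ r, G (s, r) ∂m0 = s⁻¹ * ∫ r in (1:ℝ)..b, kk s r := by
      rw [← ind_int hb, ← integral_const_mul]
      apply integral_congr_ae
      filter_upwards [m0_pos] with r hr
      simp only [hG, phi, indicator_of_mem hsb]
      by_cases hrb : r ∈ Icc 1 b
      · rw [indicator_of_mem hrb, indicator_of_mem hrb]
        unfold kk
        have hw : 0 < √s := Real.sqrt_pos.2 hs
        have hw2 : 0 < √r := Real.sqrt_pos.2 hr
        have e : s = √s ^ 2 := (Real.sq_sqrt hs.le).symm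
        generalize √s = w at *
        subst e
        field_simp
      · rw [indicator_of_notMem hrb, indicator_of_notMem hrb]; simp
    rw [e]
    exact mul_le_mul_of_nonneg_left (inner_lower hsb) (by positivity)
  · rw [indicator_of_notMem hsb]
    simp [hG, phi, indicator_of_notMem hsb]

lemma sr_sq {E : Type*} [NormedRing E] [NormedAlgebra ℂ E] [CompleteSpace E] (a : E) :
    spectralRadius ℂ a ^ 2 = spectralRadius ℂ (a ^ 2) := by
  have h1 := spectrum.pow_nnnorm_pow_one_div_tendsto_nhds_spectralRadius a
  have h2 := spectrum.pow_nnnorm_pow_one_div_tendsto_nhds_spectralRadius (a ^ 2)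
  have h3 : Filter.Tendsto (fun n : ℕ => 2 * n) Filter.atTop Filter.atTop :=
    Filter.tendsto_id.const_mul_atTop' (by norm_num)
  have h4 := ((ENNReal.continuous_pow 2).tendsto _).comp (h1.comp h3)
  refine tendsto_nhds_unique h4 (h2.congr fun n => ?_)
  simp only [Function.comp]
  rw [← ENNReal.rpow_natCast, ← ENNReal.rpow_mul, ← pow_mul]
  congr 1
  push_cast
  rcases eq_or_ne n 0 with rfl | hn
  · simp
  · have : (n : ℝ) ≠ 0 := by exact_mod_cast hn
    field_simp

/-- The spectral radius of the truncated Fourier–Plancherel operator `T`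
on `L²(ℝ⁺)` equals `1/√2`. -/
theorem spectralRadius_truncated_fourier
    (T : Lp ℂ 2 m0 →L[ℂ] Lp ℂ 2 m0)
    (hT : ∀ x : Lp ℂ 2 m0, Integrable (⇑x) m0 →
      (⇑(T x) : ℝ → ℂ) =ᵐ[m0] fun t =>
        (Real.sqrt (2 * Real.pi) : ℂ)⁻¹ *
          ∫ ξ in Ioi (0:ℝ), x ξ * Complex.exp (Complex.I * t * ξ)) :
    spectralRadius ℂ T = ENNReal.ofReal (1 / Real.sqrt 2) := by
  have hd : DenseRange (Subtype.val : {x : Lp ℂ 2 m0 | Integrable x m0} → Lp ℂ 2 m0) :=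
    dense_int.denseRange_val
  have hst : ∀ x : Lp ℂ 2 m0, Integrable x m0 → Integrable (star x : Lp ℂ 2 m0) m0 := by
    intro x hx
    refine hx.norm.mono' (Lp.aestronglyMeasurable _) ?_
    filter_upwards [Lp.coeFn_star x] with t h
    rw [h]; simp
  have hsym : ∀ x y : Lp ℂ 2 m0, BB (T x) y = BB x (T y) := by
    intro x y
    refine hd.induction_on₂ (p := fun x y => BB (T x) y = BB x (T y)) ?_ ?_ x y
    · unfold BB
      apply isClosed_eq
      · exact ((star_cont.comp (T.continuous.comp continuous_fst))).inner continuous_snd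
      · exact (star_cont.comp continuous_fst).inner (T.continuous.comp continuous_snd)
    · intro x y
      exact BB_T _ _ _ _ x.2 y.2 (hT _ x.2) (hT _ y.2)
  set S := T ^ 2 with hSdef
  have hS : ∀ x y : Lp ℂ 2 m0, Integrable x m0 → Integrable y m0 →
      inner ℂ y (S x) = Complex.I / (2 * Real.pi) * K (star y) x := by
    intro x y hx hy
    have : inner ℂ y (S x) = BB (star y) (T (T x)) := by
      unfold BB; rw [star_star, hSdef, pow_two]; rfl
    rw [this, ← hsym]
    exact main_id _ _ _ _ (hst y hy) hx (hT _ (hst y hy)) (hT _ hx)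
  have hc : ‖Complex.I / (2 * Real.pi)‖ = 1 / (2 * Real.pi) := by
    rw [norm_div, Complex.norm_I, norm_mul, Complex.norm_real, Real.norm_of_nonneg Real.pi_pos.le]
    simp
  have hns : ∀ y : Lp ℂ 2 m0, ‖star y‖ = ‖y‖ := by
    intro y
    rw [Lp.norm_def, Lp.norm_def]
    congr 1
    apply eLpNorm_congr_norm_ae
    filter_upwards [Lp.coeFn_star y] with t h1
    rw [h1, Pi.star_apply, norm_star]
  have hbd : ∀ x y : Lp ℂ 2 m0, ‖inner ℂ y (S x)‖ ≤ 1 / 4 * (‖x‖ ^ 2 + ‖y‖ ^ 2) := by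
    intro x y
    refine hd.induction_on₂
      (p := fun x y => ‖inner ℂ y (S x)‖ ≤ 1 / 4 * (‖x‖ ^ 2 + ‖y‖ ^ 2)) ?_ ?_ x y
    · apply isClosed_le
      · exact (continuous_snd.inner (S.continuous.comp continuous_fst)).norm
      · fun_prop
    · rintro ⟨x, hx⟩ ⟨y, hy⟩
      simp only
      rw [hS x y hx hy, norm_mul, hc]
      have := K_bound (star y) x
      rw [hns] at this
      calc _ ≤ 1 / (2 * Real.pi) * (Real.pi / 2 * (‖y‖ ^ 2 + ‖x‖ ^ 2)) := by gcongr
        _ = _ := by field_simp; ring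
  have hskew : ∀ x y : Lp ℂ 2 m0, inner ℂ (S y) x = - inner ℂ y (S x) := by
    intro x y
    refine hd.induction_on₂ (p := fun x y => inner ℂ (S y) x = - inner ℂ y (S x)) ?_ ?_ x y
    · apply isClosed_eq
      · exact (S.continuous.comp continuous_snd).inner continuous_fst
      · exact (continuous_snd.inner (S.continuous.comp continuous_fst)).neg
    · rintro ⟨x, hx⟩ ⟨y, hy⟩
      simp only
      rw [hS x y hx hy, ← inner_conj_symm, hS y x hy hx, map_mul]
      have := K_star (star x) y
      rw [star_star] at this
      rw [← RCLike.star_def (K := ℂ), ← this, K_symm x]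
      simp [neg_div]
  have hadj : star S = -S := by
    rw [ContinuousLinearMap.star_eq_adjoint]
    symm
    rw [ContinuousLinearMap.eq_adjoint_iff]
    intro x y
    rw [ContinuousLinearMap.neg_apply, inner_neg_left, hskew, neg_neg]
  haveI : IsStarNormal S := ⟨by rw [hadj]; exact (Commute.refl S).neg_left⟩
  have hle : ‖S‖ ≤ 1 / 2 := by
    refine S.opNorm_le_bound (by norm_num) fun x => ?_
    have h1 := hbd x ((2 : ℂ) • S x)
    rw [inner_smul_left, norm_mul, norm_smul, inner_self_eq_norm_sq_to_K] at h1
    simp at h1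
    have : ‖S x‖ ^ 2 ≤ (1 / 2 * ‖x‖) ^ 2 := by nlinarith
    exact le_of_sq_le_sq this (by positivity)
  have hge : 1 / 2 ≤ ‖S‖ := by
    have h1 : ∀ L : ℝ, 0 < L → 1 / 2 - 4 / Real.pi / L ≤ ‖S‖ := by
      intro L hL
      have hb : (1:ℝ) ≤ Real.exp L := Real.one_le_exp hL.le
      have hi : Integrable (xx (Real.exp L)) m0 :=
        (phi_integrable _).congr (xx_ae _).symm
      have h2 := K_lower hb
      have h3 := xx_norm hb
      have h4 := hS _ _ hi hi
      rw [xx_star] at h4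
      have h5 : ‖inner ℂ (xx (Real.exp L)) (S (xx (Real.exp L)))‖ ≤ ‖S‖ * L := by
        rw [Real.log_exp] at h3
        calc _ ≤ ‖xx (Real.exp L)‖ * ‖S (xx (Real.exp L))‖ := norm_inner_le_norm _ _
          _ ≤ ‖xx (Real.exp L)‖ * (‖S‖ * ‖xx (Real.exp L)‖) := by
            gcongr; exact S.le_opNorm _
          _ = ‖S‖ * ‖xx (Real.exp L)‖ ^ 2 := by ring
          _ = _ := by rw [h3]
      rw [h4, norm_mul, hc] at h5
      rw [Real.log_exp] at h2
      have hpi := Real.pi_pos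
      have h6 : 1 / (2 * Real.pi) * (Real.pi * L - 8) ≤ ‖S‖ * L :=
        le_trans (by gcongr) h5
      rw [← div_le_iff₀ hL] at h6
      refine le_trans (le_of_eq ?_) h6
      field_simp
      ring
    have h2 : Filter.Tendsto (fun L : ℝ => 1 / 2 - 4 / Real.pi / L) Filter.atTop
        (nhds (1 / 2 - 0)) :=
      tendsto_const_nhds.sub (Filter.Tendsto.const_div_atTop Filter.tendsto_id _)
    rw [sub_zero] at h2
    refine le_of_tendsto h2 ?_
    filter_upwards [Filter.eventually_gt_atTop 0] with L hL using h1 L hL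
  have hn : ‖S‖ = 1 / 2 := le_antisymm hle hge
  have hsr : spectralRadius ℂ S = ENNReal.ofReal (1 / 2) := by
    rw [IsStarNormal.spectralRadius_eq_nnnorm S, ← hn, ofReal_norm]
    rfl
  have h2 := sr_sq T
  rw [← hSdef, hsr] at h2
  have h3 : ENNReal.ofReal (1 / Real.sqrt 2) ^ 2 = ENNReal.ofReal (1 / 2) := by
    rw [← ENNReal.ofReal_pow (by positivity), div_pow, Real.sq_sqrt (by norm_num), one_pow]
  rw [← h3] at h2
  exact (ENNReal.pow_right_strictMono two_ne_zero).injective h2
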